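/- For a fixed conditional pmf p(u,v₁|s₁), the maximum over all conditional pmfs π(x|u,s₁,v₁) of F(π) := I(U;Y,S₂|V₁) − I(U;S₁|V₁) is attained at a deterministic kernel: there exists a function f: 𝒰×𝒮₁×𝒱₁ → 𝒳 such that the conditional pmf π_f(x|u,s₁,v₁) = 1 if x = f(u,s₁,v₁) and 0 otherwise satisfies F(π_f) = max_π F(π). -/

import Mathlib

open scoped Classical

/-- The probability of the event `f = a` under the pmf `P` on a finite space. -/
noncomputable def pr {Ω A : Type*} [Fintype Ω] (P : Ω → ℝ) (f : Ω → A) (a : A) : ℝ :=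
  ∑ ω, if f ω = a then P ω else 0

/-- Shannon entropy `H(f)` (convention `0 log 0 = 0`, automatic since `Real.log 0 = 0`). -/
noncomputable def ent {Ω A : Type*} [Fintype Ω] [Fintype A] (P : Ω → ℝ) (f : Ω → A) : ℝ :=
  -∑ a, pr P f a * Real.log (pr P f a)

/-- Mutual information `I(f;g) = H(f) + H(g) − H(f,g)`. -/
noncomputable def mi {Ω A B : Type*} [Fintype Ω] [Fintype A] [Fintype B]
    (P : Ω → ℝ) (f : Ω → A) (g : Ω → B) : ℝ :=
  ent P f + ent P g - ent P (fun ω => (f ω, g ω))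

/-- Conditional mutual information `I(f;g|h) = H(f,h) + H(g,h) − H(f,g,h) − H(h)`. -/
noncomputable def cmi {Ω A B C : Type*} [Fintype Ω] [Fintype A] [Fintype B] [Fintype C]
    (P : Ω → ℝ) (f : Ω → A) (g : Ω → B) (h : Ω → C) : ℝ :=
  ent P (fun ω => (f ω, h ω)) + ent P (fun ω => (g ω, h ω)) -
    ent P (fun ω => (f ω, g ω, h ω)) - ent P h

/-- The joint pmf `p(s₁,s₂,v₁,u,x,y) = p(s₁,s₂) p(u,v₁|s₁) π(x|u,s₁,v₁) p(y|x,s₁,s₂)`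
as a pmf on the product space `S1 × S2 × V1 × U × X × Y`. -/
noncomputable def jointCC {S1 S2 V1 U X Y : Type*}
    (p : S1 → S2 → ℝ) (puv : S1 → U → V1 → ℝ) (ch : X → S1 → S2 → Y → ℝ)
    (π : U → S1 → V1 → X → ℝ) : S1 × S2 × V1 × U × X × Y → ℝ :=
  fun ω => p ω.1 ω.2.1 * puv ω.1 ω.2.2.2.1 ω.2.2.1 *
    π ω.2.2.2.1 ω.1 ω.2.2.1 ω.2.2.2.2.1 * ch ω.2.2.2.2.1 ω.1 ω.2.1 ω.2.2.2.2.2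

/-- `F(π) = I(U;Y,S₂|V₁) − I(U;S₁|V₁)`, computed for `(S₁,S₂,V₁,U,X,Y)` jointly
distributed according to the joint pmf induced by `π`. -/
noncomputable def Fcc {S1 S2 V1 U X Y : Type*}
    [Fintype S1] [Fintype S2] [Fintype V1] [Fintype U] [Fintype X] [Fintype Y]
    (p : S1 → S2 → ℝ) (puv : S1 → U → V1 → ℝ) (ch : X → S1 → S2 → Y → ℝ)
    (π : U → S1 → V1 → X → ℝ) : ℝ :=
  cmi (jointCC p puv ch π) (fun ω => ω.2.2.2.1) (fun ω => (ω.2.2.2.2.2, ω.2.1))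
      (fun ω => ω.2.2.1) -
    cmi (jointCC p puv ch π) (fun ω => ω.2.2.2.1) (fun ω => ω.1) (fun ω => ω.2.2.1)

/-- The tangent line bound `r log (c / r) ≤ c - r`, including the case `r = 0`. -/
lemma mul_log_sub_log_le {c r : ℝ} (hr : 0 ≤ r) (hc : 0 ≤ c) (h : c = 0 → r = 0) :
    r * (Real.log c - Real.log r) ≤ c - r := by
  rcases hr.eq_or_lt with rfl | hr
  · simpa using hc
  have hc : 0 < c := lt_of_le_of_ne hc fun h0 => hr.ne' (h h0.symm)
  rw [← Real.log_div hc.ne' hr.ne']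
  have := Real.log_le_sub_one_of_pos (div_pos hc hr)
  calc r * Real.log (c / r) ≤ r * (c / r - 1) := by gcongr
    _ = c - r := by field_simp

/-- The two-term log-sum inequality. -/
lemma mul_log_sub_log_add_le {r₁ r₂ R₁ R₂ : ℝ} (h₁ : 0 ≤ r₁) (h₂ : 0 ≤ r₂)
    (hR₁ : r₁ ≤ R₁) (hR₂ : r₂ ≤ R₂) :
    (r₁ + r₂) * (Real.log (r₁ + r₂) - Real.log (R₁ + R₂)) ≤
      r₁ * (Real.log r₁ - Real.log R₁) + r₂ * (Real.log r₂ - Real.log R₂) := by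
  rcases (add_nonneg h₁ h₂).eq_or_lt with h0 | hs
  · obtain rfl : r₁ = 0 := by linarith
    obtain rfl : r₂ = 0 := by linarith
    simp
  have hS : 0 < R₁ + R₂ := by linarith
  have key : ∀ r R : ℝ, 0 ≤ r → r ≤ R →
      r * (Real.log (r₁ + r₂) - Real.log (R₁ + R₂)) - r * (Real.log r - Real.log R) ≤
        R * (r₁ + r₂) / (R₁ + R₂) - r := by
    intro r R hr hR
    rcases hr.eq_or_lt with rfl | hr
    · have : 0 ≤ R * (r₁ + r₂) / (R₁ + R₂) := by positivity
      simpa using this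
    have hRp : 0 < R := by linarith
    have hc : 0 < R * (r₁ + r₂) / (R₁ + R₂) := by positivity
    have := mul_log_sub_log_le hr.le hc.le (fun h => absurd h hc.ne')
    rw [Real.log_div (by positivity) hS.ne', Real.log_mul hRp.ne' hs.ne'] at this
    linarith
  have e : R₁ * (r₁ + r₂) / (R₁ + R₂) + R₂ * (r₁ + r₂) / (R₁ + R₂) = r₁ + r₂ := by
    field_simp
  linarith [key r₁ R₁ h₁ hR₁, key r₂ R₂ h₂ hR₂]

lemma mul_log_sub_log_smul {a r R : ℝ} (hr : 0 ≤ r) (hR : r ≤ R) :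
    (a * r) * (Real.log (a * r) - Real.log (a * R)) = a * (r * (Real.log r - Real.log R)) := by
  rcases eq_or_ne a 0 with rfl | ha
  · simp
  rcases hr.eq_or_lt with rfl | hr
  · simp
  rw [Real.log_mul ha hr.ne', Real.log_mul ha (hr.trans_le hR).ne']
  ring

section Entropy

variable {Ω A B : Type*} [Fintype Ω]

lemma pr_nonneg {P : Ω → ℝ} (hP : ∀ ω, 0 ≤ P ω) (f : Ω → A) (a : A) : 0 ≤ pr P f a :=
  Finset.sum_nonneg fun ω _ => by split_ifs <;> simp [hP]

lemma pr_le_pr_comp {P : Ω → ℝ} (hP : ∀ ω, 0 ≤ P ω) (f : Ω → A) (k : A → B) (a : A) :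
    pr P f a ≤ pr P (fun ω => k (f ω)) (k a) := by
  refine Finset.sum_le_sum fun ω _ => ?_
  by_cases h : f ω = a
  · simp [h]
  · simp only [h, if_false]
    split_ifs <;> simp [hP]

lemma pr_add_smul (P Q : Ω → ℝ) (c d : ℝ) (f : Ω → A) (a : A) :
    pr (c • P + d • Q) f a = c * pr P f a + d * pr Q f a := by
  simp only [pr, Finset.mul_sum, ← Finset.sum_add_distrib]
  refine Finset.sum_congr rfl fun ω _ => ?_
  split_ifs <;> simp

lemma pr_comp [Fintype A] (P : Ω → ℝ) (f : Ω → A) (k : A → B) (b : B) :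
    pr P (fun ω => k (f ω)) b = ∑ a, if k a = b then pr P f a else 0 := by
  simp only [pr, ← Finset.sum_filter]
  rw [Finset.sum_comm' (t' := Finset.univ.filter fun ω => k (f ω) = b) (s' := fun ω => {f ω})]
  · simp
  · intro a ω
    simp only [Finset.mem_filter, Finset.mem_univ, true_and, Finset.mem_singleton]
    grind

/-- `H(k(f)) - H(f)`, the negative conditional entropy `-H(f | k(f))`, as a single sum. -/
lemma ent_comp_sub_ent [Fintype A] [Fintype B] (P : Ω → ℝ) (f : Ω → A) (k : A → B) :
    ent P (fun ω => k (f ω)) - ent P f =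
      ∑ a, pr P f a * (Real.log (pr P f a) - Real.log (pr P (fun ω => k (f ω)) (k a))) := by
  have h : ∑ b, pr P (fun ω => k (f ω)) b * Real.log (pr P (fun ω => k (f ω)) b) =
      ∑ a, pr P f a * Real.log (pr P (fun ω => k (f ω)) (k a)) := by
    calc _ = ∑ b, ∑ a, if k a = b then
          pr P f a * Real.log (pr P (fun ω => k (f ω)) (k a)) else 0 := by
          refine Finset.sum_congr rfl fun b _ => ?_
          nth_rewrite 1 [pr_comp]
          rw [Finset.sum_mul]
          refine Finset.sum_congr rfl fun a _ => ?_
          split_ifs with hab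
          · rw [hab]
          · rw [zero_mul]
      _ = _ := by
          rw [Finset.sum_comm]
          simp
  simp only [ent, h, mul_sub, Finset.sum_sub_distrib]
  ring

/-- The negative conditional entropy `-H(f | k(f))` is convex in the distribution. -/
lemma convexOn_ent_comp_sub_ent [Fintype A] [Fintype B] (f : Ω → A) (k : A → B) :
    ConvexOn ℝ {P : Ω → ℝ | ∀ ω, 0 ≤ P ω} fun P => ent P (fun ω => k (f ω)) - ent P f := by
  refine ⟨fun P hP Q hQ c d hc hd _ ω => ?_, fun P hP Q hQ c d hc hd _ => ?_⟩
  · have := mul_nonneg hc (hP ω)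
    have := mul_nonneg hd (hQ ω)
    simpa using by linarith
  simp only [ent_comp_sub_ent, smul_eq_mul, Finset.mul_sum, ← Finset.sum_add_distrib, pr_add_smul]
  refine Finset.sum_le_sum fun a _ => ?_
  have hPa := pr_nonneg hP f a
  have hQa := pr_nonneg hQ f a
  have hPk := pr_le_pr_comp hP f k a
  have hQk := pr_le_pr_comp hQ f k a
  rw [← mul_log_sub_log_smul hPa hPk, ← mul_log_sub_log_smul hQa hQk]
  exact mul_log_sub_log_add_le (by positivity) (by positivity) (by gcongr) (by gcongr)

end Entropy

/-- A convex function on a finite product of simplices is maximized by a choice of vertices. -/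
lemma ConvexOn.exists_vertex_max {ι X : Type*} [Finite ι] [Fintype X] [Nonempty X]
    {g : (ι → X → ℝ) → ℝ} (hg : ConvexOn ℝ (Set.univ.pi fun _ => stdSimplex ℝ X) g) :
    ∃ f : ι → X, ∀ ρ ∈ Set.univ.pi fun _ : ι => stdSimplex ℝ X,
      g ρ ≤ g fun i x => if x = f i then 1 else 0 := by
  obtain ⟨f, hf⟩ := Finite.exists_max fun f : ι → X => g fun i x => if x = f i then 1 else 0
  refine ⟨f, fun ρ hρ => ?_⟩
  have hsub : (Set.univ.pi fun _ : ι => Set.range fun x' x : X => if x' = x then (1 : ℝ) else 0) ⊆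
      Set.univ.pi fun _ => stdSimplex ℝ X := by
    refine Set.pi_mono fun i _ => ?_
    rw [← convexHull_basis_eq_stdSimplex]
    exact subset_convexHull ℝ _
  have hρ' : ρ ∈ convexHull ℝ
      (Set.univ.pi fun _ : ι => Set.range fun x' x : X => if x' = x then (1 : ℝ) else 0) := by
    rw [convexHull_pi]
    simpa only [convexHull_basis_eq_stdSimplex] using hρ
  obtain ⟨σ, hσ, hle⟩ := hg.exists_ge_of_mem_convexHull hsub hρ'
  choose f' hf' using fun i => hσ i (Set.mem_univ i)
  have : σ = fun i x => if x = f' i then 1 else 0 := by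
    ext i x
    rw [← hf' i]
    simp only [eq_comm]
  exact hle.trans (this ▸ hf f')

section Channel

variable {S1 S2 V1 U X Y : Type*}

lemma jointCC_add_smul (p : S1 → S2 → ℝ) (puv : S1 → U → V1 → ℝ) (ch : X → S1 → S2 → Y → ℝ)
    (π π' : U → S1 → V1 → X → ℝ) (c d : ℝ) :
    jointCC p puv ch (c • π + d • π') = c • jointCC p puv ch π + d • jointCC p puv ch π' := by
  ext ω
  simp only [jointCC, Pi.add_apply, Pi.smul_apply, smul_eq_mul]
  ring

variable [Fintype S1] [Fintype S2] [Fintype V1] [Fintype U] [Fintype X] [Fintype Y]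

/-- The law of `(S₁,S₂,V₁,U)` does not depend on the kernel `π`. -/
lemma pr_jointCC_of_input {A : Type*} (p : S1 → S2 → ℝ) (puv : S1 → U → V1 → ℝ)
    (ch : X → S1 → S2 → Y → ℝ) (hch : ∀ x s1 s2, ∑ y, ch x s1 s2 y = 1)
    (π : U → S1 → V1 → X → ℝ) (hπ : ∀ u s1 v1, ∑ x, π u s1 v1 x = 1)
    (g : S1 → S2 → V1 → U → A) (a : A) :
    pr (jointCC p puv ch π) (fun ω => g ω.1 ω.2.1 ω.2.2.1 ω.2.2.2.1) a =
      ∑ s1, ∑ s2, ∑ v1, ∑ u, if g s1 s2 v1 u = a then p s1 s2 * puv s1 u v1 else 0 := by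
  simp only [pr, jointCC, Fintype.sum_prod_type]
  refine Finset.sum_congr rfl fun s1 _ => Finset.sum_congr rfl fun s2 _ =>
    Finset.sum_congr rfl fun v1 _ => Finset.sum_congr rfl fun u _ => ?_
  split_ifs
  · simp [← Finset.mul_sum, hch, hπ]
  · simp

lemma ent_jointCC_of_input {A : Type*} [Fintype A] (p : S1 → S2 → ℝ) (puv : S1 → U → V1 → ℝ)
    (ch : X → S1 → S2 → Y → ℝ) (hch : ∀ x s1 s2, ∑ y, ch x s1 s2 y = 1)
    {π π' : U → S1 → V1 → X → ℝ} (hπ : ∀ u s1 v1, ∑ x, π u s1 v1 x = 1)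
    (hπ' : ∀ u s1 v1, ∑ x, π' u s1 v1 x = 1) (g : S1 → S2 → V1 → U → A) :
    ent (jointCC p puv ch π) (fun ω => g ω.1 ω.2.1 ω.2.2.1 ω.2.2.2.1) =
      ent (jointCC p puv ch π') (fun ω => g ω.1 ω.2.1 ω.2.2.1 ω.2.2.2.1) := by
  simp only [ent, pr_jointCC_of_input p puv ch hch π hπ, pr_jointCC_of_input p puv ch hch π' hπ']

end Channel

/-- for a fixed conditional pmf `p(u,v₁|s₁)`, the maximum of
`F(π) = I(U;Y,S₂|V₁) − I(U;S₁|V₁)` over conditional pmfs `π(x|u,s₁,v₁)` is attained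
at a deterministic kernel `π_f(x|u,s₁,v₁) = 𝟙{x = f(u,s₁,v₁)}`. -/
theorem Fcc_max_deterministic {S1 S2 V1 U X Y : Type*}
    [Fintype S1] [Fintype S2] [Fintype V1] [Fintype U] [Fintype X] [Fintype Y]
    [Nonempty S1] [Nonempty S2] [Nonempty V1] [Nonempty U] [Nonempty X] [Nonempty Y]
    (p : S1 → S2 → ℝ) (hp0 : ∀ s1 s2, 0 ≤ p s1 s2) (hp1 : ∑ s1, ∑ s2, p s1 s2 = 1)
    (puv : S1 → U → V1 → ℝ) (hpuv0 : ∀ s1 u v1, 0 ≤ puv s1 u v1)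
    (hpuv1 : ∀ s1, ∑ u, ∑ v1, puv s1 u v1 = 1)
    (ch : X → S1 → S2 → Y → ℝ) (hch0 : ∀ x s1 s2 y, 0 ≤ ch x s1 s2 y)
    (hch1 : ∀ x s1 s2, ∑ y, ch x s1 s2 y = 1) :
    ∃ f : U → S1 → V1 → X,
      ∀ π : U → S1 → V1 → X → ℝ,
        (∀ u s1 v1 x, 0 ≤ π u s1 v1 x) → (∀ u s1 v1, ∑ x, π u s1 v1 x = 1) →
        Fcc p puv ch π ≤
          Fcc p puv ch (fun u s1 v1 x => if x = f u s1 v1 then (1:ℝ) else 0) := by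
  have hconv : ConvexOn ℝ (Set.univ.pi fun _ : U × S1 × V1 => stdSimplex ℝ X)
      fun ρ : U × S1 × V1 → X → ℝ =>
        ent (jointCC p puv ch fun u s1 v1 => ρ (u, s1, v1))
            (fun ω => ((ω.2.2.2.2.2, ω.2.1), ω.2.2.1)) -
          ent (jointCC p puv ch fun u s1 v1 => ρ (u, s1, v1))
            (fun ω => (ω.2.2.2.1, (ω.2.2.2.2.2, ω.2.1), ω.2.2.1)) := by
    have hnn : ∀ ρ ∈ Set.univ.pi fun _ : U × S1 × V1 => stdSimplex ℝ X, ∀ ω,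
        0 ≤ jointCC p puv ch (fun u s1 v1 => ρ (u, s1, v1)) ω := fun ρ hρ ω =>
      mul_nonneg (mul_nonneg (mul_nonneg (hp0 _ _) (hpuv0 _ _ _))
        ((hρ _ (Set.mem_univ _)).1 _)) (hch0 _ _ _ _)
    refine ⟨convex_pi fun _ _ => convex_stdSimplex ℝ X, fun ρ hρ σ hσ c d hc hd hcd => ?_⟩
    have hlin := jointCC_add_smul p puv ch (fun u s1 v1 => ρ (u, s1, v1))
      (fun u s1 v1 => σ (u, s1, v1)) c d
    have := (convexOn_ent_comp_sub_ent (Ω := S1 × S2 × V1 × U × X × Y)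
      (fun ω => (ω.2.2.2.1, (ω.2.2.2.2.2, ω.2.1), ω.2.2.1)) Prod.snd).2
      (hnn ρ hρ) (hnn σ hσ) hc hd hcd
    rw [← hlin] at this
    exact this
  obtain ⟨f, hf⟩ := hconv.exists_vertex_max
  refine ⟨fun u s1 v1 => f (u, s1, v1), fun π hπ0 hπ1 => ?_⟩
  have hmax := hf (fun i => π i.1 i.2.1 i.2.2) fun i _ => ⟨hπ0 _ _ _, hπ1 _ _ _⟩
  have hdet : ∀ u s1 v1, ∑ x, (if x = f (u, s1, v1) then (1 : ℝ) else 0) = 1 := by simp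
  have h₁ := ent_jointCC_of_input p puv ch hch1 hπ1 hdet fun s1 _ v1 _ => (s1, v1)
  have h₂ := ent_jointCC_of_input p puv ch hch1 hπ1 hdet fun s1 _ v1 u => (u, s1, v1)
  simp only [Fcc, cmi]
  linarith
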